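/- (R-safety: a block committed by f+1 honest nodes is never revoked.) Suppose vote : N → Block gives the unique block each honest node voted for at a fixed sequence, B ⊆ N with |B| ≤ f is the set of Byzantine nodes, and H₁ ⊆ N is a set of honest nodes (H₁ ∩ B = ∅) with |H₁| ≥ f+1 such that vote i = b₁ for all i ∈ H₁. Then there is no set S₂ ⊆ N with |S₂| ≥ 2f+1 and a block b₂ ≠ b₁ such that every honest node i ∈ S₂ has vote i = b₂; i.e., no conflicting block at that sequence can gather a quorum of 2f+1 votes, even under equivocation by a Byzantine primary. -/

import Mathlib

/-- (R-safety.) If a block `b₁` is committed by at least `f+1` honest nodes,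
then no conflicting block at the same sequence can gather a quorum of
`2f+1` votes. -/
theorem r_safety {ι : Type*} [DecidableEq ι] {Block : Type*} (f : ℕ)
    (N B H₁ : Finset ι) (vote : ι → Block) (b₁ : Block)
    (hN : N.card = 3 * f + 1) (hB : B ⊆ N) (hBcard : B.card ≤ f)
    (hH₁ : H₁ ⊆ N) (hH₁B : H₁ ∩ B = ∅) (hH₁card : f + 1 ≤ H₁.card)
    (hvote₁ : ∀ i ∈ H₁, vote i = b₁) :
    ¬ ∃ (S₂ : Finset ι) (b₂ : Block), S₂ ⊆ N ∧ 2 * f + 1 ≤ S₂.card ∧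
      b₂ ≠ b₁ ∧ ∀ i ∈ S₂, i ∉ B → vote i = b₂ := by
  rintro ⟨S₂, b₂, hS₂, hS₂card, hne, hvote₂⟩
  obtain ⟨i, hi⟩ := Finset.inter_nonempty_of_card_lt_card_add_card hH₁ hS₂ (by omega)
  obtain ⟨hi₁, hi₂⟩ := Finset.mem_inter.mp hi
  have hiB : i ∉ B := Finset.disjoint_left.mp (Finset.disjoint_iff_inter_eq_empty.mpr hH₁B) hi₁
  exact hne ((hvote₂ i hi₂ hiB).symm.trans (hvote₁ i hi₁))
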